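/- If G is a connected k-STI graph of order n ≥ 5, then diam(G) ≤ (n+k)/2 − 1. -/

import Mathlib

/-- The transmission of a vertex: sum of distances to all vertices. -/
noncomputable def Tr {V : Type*} [Fintype V] (G : SimpleGraph V) (u : V) : ℕ :=
  ∑ x : V, G.dist u x

/-- `G` is a `k`-STI graph: transmissions of endpoints of every edge differ by exactly `k`. -/
def IsKSTI {V : Type*} [Fintype V] (G : SimpleGraph V) (k : ℕ) : Prop :=
  ∀ u v : V, G.Adj u v → ((Tr G u : ℤ) - (Tr G v : ℤ)).natAbs = k

/-- Any two vertices of a connected graph are joined by an isometrically embedded path. -/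
theorem SimpleGraph.Connected.exists_geodesic {V : Type*} {G : SimpleGraph V}
    (hconn : G.Connected) (a b : V) :
    ∃ P : ℕ → V, P 0 = a ∧ P (G.dist a b) = b ∧
      ∀ i j, i ≤ j → j ≤ G.dist a b → G.dist (P i) (P j) + i = j := by
  obtain ⟨p, hp⟩ := hconn.exists_walk_length_eq_dist a b
  have hb : p.getVert (G.dist a b) = b := by rw [← hp]; exact p.getVert_length
  have upper : ∀ i m, i + m ≤ G.dist a b → G.dist (p.getVert i) (p.getVert (i + m)) ≤ m := by
    intro i m
    induction m with
    | zero => simp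
    | succ m ih =>
      intro h
      have h1 := ih (by omega)
      have hadj := p.adj_getVert_succ (i := i + m) (by omega)
      have h2 := SimpleGraph.dist_eq_one_iff_adj.mpr hadj
      have h3 := hconn.dist_triangle (u := p.getVert i) (v := p.getVert (i + m))
        (w := p.getVert (i + m + 1))
      rw [← add_assoc]
      omega
  refine ⟨p.getVert, p.getVert_zero, hb, fun i j hij hj => ?_⟩
  have h1 := upper 0 i (by omega)
  have h2 := upper i (j - i) (by omega)
  have h3 := upper j (G.dist a b - j) (by omega)
  rw [zero_add, p.getVert_zero] at h1
  rw [Nat.add_sub_cancel' hij] at h2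
  rw [Nat.add_sub_cancel' hj, hb] at h3
  have h4 := hconn.dist_triangle (u := a) (v := p.getVert i) (w := b)
  have h5 := hconn.dist_triangle (u := p.getVert i) (v := p.getVert j) (w := b)
  omega

/-- The set of vertices that are closer to `u` than to `v`. -/
noncomputable def closerSet {V : Type*} [Fintype V] (G : SimpleGraph V) (u v : V) : Finset V :=
  {x | G.dist u x < G.dist v x}

theorem mem_closerSet {V : Type*} [Fintype V] {G : SimpleGraph V} {u v x : V} :
    x ∈ closerSet G u v ↔ G.dist u x < G.dist v x := by
  simp [closerSet]

/-- A set of indices embeds into any set containing its image under an isometric path. -/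
theorem card_le_of_geodesic {V : Type*} {G : SimpleGraph V} {P : ℕ → V} {d : ℕ}
    (hP : ∀ i j, i ≤ j → j ≤ d → G.dist (P i) (P j) + i = j) {s : Finset ℕ} {t : Finset V}
    (hs : ∀ i ∈ s, i ≤ d) (hst : ∀ i ∈ s, P i ∈ t) : s.card ≤ t.card := by
  refine Finset.card_le_card_of_injOn P hst fun i hi j hj h => ?_
  rcases le_total i j with hij | hij
  · have := hP i j hij (hs j hj)
    simp only [h, SimpleGraph.dist_self] at this
    omega
  · have := hP j i hij (hs i hi)
    simp only [h, SimpleGraph.dist_self] at this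
    omega

/-- Along a walk, transmissions modulo `2 * k` are determined by the length of the walk. -/
theorem IsKSTI.dvd_of_walk {V : Type*} [Fintype V] {G : SimpleGraph V} {k : ℕ}
    (h : IsKSTI G k) {u v : V} (p : G.Walk u v) :
    (2 * k : ℤ) ∣ (Tr G u : ℤ) - Tr G v - k * p.length := by
  induction p with
  | nil => simp
  | @cons u v w hadj p ih =>
    obtain ⟨c, hc⟩ := ih
    have h1 := h u v hadj
    rw [SimpleGraph.Walk.length_cons]
    push_cast
    rcases Int.natAbs_eq ((Tr G u : ℤ) - Tr G v) with h2 | h2 <;> rw [h1] at h2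
    · exact ⟨c, by linarith⟩
    · exact ⟨c - 1, by linarith⟩

theorem IsKSTI.dist_ne {V : Type*} [Fintype V] {G : SimpleGraph V} {k : ℕ}
    (h : IsKSTI G k) (hconn : G.Connected) (hk : 1 ≤ k) {u v : V} (hadj : G.Adj u v) (x : V) :
    G.dist u x ≠ G.dist v x := by
  intro he
  obtain ⟨p, hp⟩ := hconn.exists_walk_length_eq_dist u x
  obtain ⟨q, hq⟩ := hconn.exists_walk_length_eq_dist v x
  have h1 := dvd_sub (h.dvd_of_walk p) (h.dvd_of_walk q)
  rw [hp, hq, he, sub_sub_sub_cancel_right, sub_sub_sub_cancel_right] at h1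
  have h2 := Int.natAbs_dvd_natAbs.mpr h1
  rw [h u v hadj] at h2
  have h3 := Nat.le_of_dvd hk h2
  omega

theorem IsKSTI.card_add_card {V : Type*} [Fintype V] {G : SimpleGraph V} {k : ℕ}
    (h : IsKSTI G k) (hconn : G.Connected) (hk : 1 ≤ k) {u v : V} (hadj : G.Adj u v) :
    (closerSet G u v).card + (closerSet G v u).card = Fintype.card V := by
  classical
  rw [← Finset.card_union_of_disjoint, ← Finset.card_univ]
  · congr 1
    ext x
    have := h.dist_ne hconn hk hadj x
    simp only [Finset.mem_union, mem_closerSet, Finset.mem_univ, iff_true]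
    omega
  · rw [Finset.disjoint_left]
    intro x
    simp only [mem_closerSet]
    omega

theorem Tr_sub_Tr {V : Type*} [Fintype V] {G : SimpleGraph V} (hconn : G.Connected)
    {u v : V} (hadj : G.Adj u v) :
    (Tr G u : ℤ) - Tr G v = (closerSet G v u).card - (closerSet G u v).card := by
  simp only [Tr, closerSet, Finset.card_filter]
  push_cast
  rw [← Finset.sum_sub_distrib, ← Finset.sum_sub_distrib]
  refine Finset.sum_congr rfl fun x _ => ?_
  have h1 := hconn.dist_triangle (u := u) (v := v) (w := x)
  have h2 := hconn.dist_triangle (u := v) (v := u) (w := x)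
  rw [SimpleGraph.dist_eq_one_iff_adj.mpr hadj] at h1
  rw [SimpleGraph.dist_eq_one_iff_adj.mpr hadj.symm] at h2
  split_ifs <;> omega

theorem stmt_15 {V : Type*} [Fintype V] (G : SimpleGraph V) (hconn : G.Connected)
    (hn : 5 ≤ Fintype.card V) (k : ℕ) (hk : 1 ≤ k) (hsti : IsKSTI G k) :
    G.diam ≤ (Fintype.card V + k) / 2 - 1 := by
  classical
  by_contra hlt
  have card_edge : ∀ u v, G.Adj u v →
      (closerSet G u v).card + (closerSet G v u).card = Fintype.card V ∧
      (((closerSet G v u).card : ℤ) - (closerSet G u v).card).natAbs = k := fun u v huv =>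
    ⟨hsti.card_add_card hconn hk huv, by rw [← Tr_sub_Tr hconn huv]; exact hsti u v huv⟩
  have := hconn.nonempty
  obtain ⟨a, b, hab⟩ := G.exists_dist_eq_diam
  obtain ⟨P, hPa, hPb, hP⟩ := hconn.exists_geodesic a b
  rw [← hab] at hlt
  generalize hd : G.dist a b = d at *
  have hd3 : 3 ≤ d := by omega
  have adj_P : ∀ i, i + 1 ≤ d → G.Adj (P i) (P (i + 1)) := fun i hi =>
    SimpleGraph.dist_eq_one_iff_adj.mp (by have := hP i (i + 1) (by omega) hi; omega)
  have mem_right : ∀ i j, i + 1 ≤ j → j ≤ d → P j ∈ closerSet G (P (i + 1)) (P i) := by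
    intro i j hij hj
    have h1 := hP i j (by omega) hj
    have h2 := hP (i + 1) j hij hj
    rw [mem_closerSet]
    omega
  have mem_left : ∀ i j, j ≤ i → i + 1 ≤ d → P j ∈ closerSet G (P i) (P (i + 1)) := by
    intro i j hij hi
    have h1 := hP j i hij (by omega)
    have h2 := hP j (i + 1) (by omega) hi
    rw [mem_closerSet, G.dist_comm, G.dist_comm (u := P (i + 1))]
    omega
  have hA : d ≤ (closerSet G (P 1) (P 0)).card := by
    have := card_le_of_geodesic hP (s := Finset.Icc 1 d) (t := closerSet G (P 1) (P 0))
      (fun i hi => (Finset.mem_Icc.mp hi).2) fun i hi =>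
        mem_right 0 i (Finset.mem_Icc.mp hi).1 (Finset.mem_Icc.mp hi).2
    simpa using this
  obtain ⟨hA1, hA2⟩ := card_edge _ _ (adj_P 0 (by omega))
  rw [zero_add] at hA1 hA2
  by_cases hy : ∃ y, G.Adj a y ∧ y ≠ P 1
  · obtain ⟨y, hay, hy1⟩ := hy
    have hay1 := SimpleGraph.dist_eq_one_iff_adj.mpr hay
    -- `y` is not on the path, hence it is not closer to `P (d - 1)` than to `b`
    obtain ⟨e, rfl⟩ : ∃ e, d = e + 1 := ⟨d - 1, by omega⟩
    have hyP : y ∉ closerSet G (P e) (P (e + 1)) := by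
      intro hmem
      have hB : (Finset.range (e + 1)).card ≤
          ((closerSet G (P e) (P (e + 1))).erase y).card := by
        refine card_le_of_geodesic hP (fun i hi => (Finset.mem_range.mp hi).le) fun i hi => ?_
        have hi' := Finset.mem_range.mp hi
        refine Finset.mem_erase.mpr ⟨?_, mem_left e i (by omega) le_rfl⟩
        rintro rfl
        have h1 := hP 0 i (by omega) (by omega)
        rw [hPa, hay1] at h1
        exact hy1 (by rw [← h1])
      rw [Finset.card_range, Finset.card_erase_of_mem hmem] at hB
      obtain ⟨h1, h2⟩ := card_edge _ _ (adj_P e le_rfl)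
      omega
    have hne := hsti.dist_ne hconn hk (adj_P e le_rfl) y
    rw [mem_closerSet] at hyP
    rw [hPb] at hyP hne
    have h1 := hP 0 e (by omega) (by omega)
    rw [hPa] at h1
    have h2 := hconn.dist_triangle (u := P e) (v := a) (w := y)
    have h3 := hconn.dist_triangle (u := a) (v := y) (w := b)
    rw [G.dist_comm (u := P e) (v := a)] at h2
    have h4 : G.dist y b = e := by
      rw [G.dist_comm]
      rw [G.dist_comm (u := y)] at h3
      omega
    have h5 : G.dist (P e) y = e + 1 := by
      rw [G.dist_comm (u := b), h4] at hyP hne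
      omega
    obtain ⟨Q, hQy, hQb, hQ⟩ := hconn.exists_geodesic y b
    rw [h4] at hQb hQ
    have hQP : ∀ j < e, ∀ i ≤ e + 1, Q j ≠ P i := by
      intro j hj i hi hji
      have g1 := hQ 0 j (by omega) (by omega)
      have g2 := hQ j e (by omega) le_rfl
      have g3 := hP 0 i (by omega) (by omega)
      rw [hQy] at g1
      rw [hQb] at g2
      rw [hPa, ← hji] at g3
      have g4 := hconn.dist_triangle (u := a) (v := Q j) (w := b)
      have g5 := hconn.dist_triangle (u := a) (v := y) (w := Q j)
      have g6 := hP i e (by omega) (by omega)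
      have g7 := hconn.dist_triangle (u := y) (v := Q j) (w := P e)
      rw [hji] at g7 g1
      rw [G.dist_comm (u := y) (v := P e)] at g7
      rw [hji] at g2 g3 g4 g5
      omega
    have hcP : e + 2 ≤ ((Finset.range (e + 2)).image P).card := by
      have := card_le_of_geodesic hP (s := Finset.range (e + 2))
        (t := (Finset.range (e + 2)).image P)
        (fun i hi => by have := Finset.mem_range.mp hi; omega)
        fun i hi => Finset.mem_image_of_mem P hi
      rwa [Finset.card_range] at this
    have hcQ : e ≤ ((Finset.range e).image Q).card := by
      have := card_le_of_geodesic hQ (s := Finset.range e)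
        (t := (Finset.range e).image Q)
        (fun i hi => (Finset.mem_range.mp hi).le)
        fun i hi => Finset.mem_image_of_mem Q hi
      rwa [Finset.card_range] at this
    have hdisj : Disjoint ((Finset.range (e + 2)).image P) ((Finset.range e).image Q) := by
      rw [Finset.disjoint_left]
      intro x hx hx'
      obtain ⟨i, hi, rfl⟩ := Finset.mem_image.mp hx
      obtain ⟨j, hj, hji⟩ := Finset.mem_image.mp hx'
      have := Finset.mem_range.mp hi
      exact hQP j (Finset.mem_range.mp hj) i (by omega) hji
    have hc := Finset.card_le_univ
      ((Finset.range (e + 2)).image P ∪ (Finset.range e).image Q)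
    rw [Finset.card_union_of_disjoint hdisj] at hc
    omega
  · -- `a` is a leaf, so `G` is a path
    push Not at hy
    have hsub : closerSet G (P 0) (P 1) ⊆ {a} := by
      intro x hx
      rw [Finset.mem_singleton]
      by_contra hxa
      obtain ⟨Q, hQa, hQx, hQ⟩ := hconn.exists_geodesic a x
      have hpos := hconn.pos_dist_of_ne (Ne.symm hxa)
      have h1 := hQ 0 1 (by omega) hpos
      have h2 := hQ 1 _ hpos le_rfl
      rw [hQa] at h1
      rw [hy (Q 1) (SimpleGraph.dist_eq_one_iff_adj.mp h1), hQx] at h2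
      rw [mem_closerSet, hPa] at hx
      omega
    have hle := Finset.card_le_card hsub
    rw [Finset.card_singleton] at hle
    obtain ⟨h1, h2⟩ := card_edge _ _ (adj_P 1 (by omega))
    have h3 := card_le_of_geodesic hP (s := Finset.Icc 2 d) (t := closerSet G (P 2) (P 1))
      (fun i hi => (Finset.mem_Icc.mp hi).2) fun i hi =>
        mem_right 1 i (Finset.mem_Icc.mp hi).1 (Finset.mem_Icc.mp hi).2
    have h4 := card_le_of_geodesic hP (s := Finset.range 2) (t := closerSet G (P 1) (P 2))
      (fun i hi => by have := Finset.mem_range.mp hi; omega) fun i hi =>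
        mem_left 1 i (by have := Finset.mem_range.mp hi; omega) (by omega)
    rw [Nat.card_Icc] at h3
    rw [Finset.card_range] at h4
    norm_num at h1 h2
    omega
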